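/- arXiv:2312.08278 — 9 statements merged into one kernel-verified Lean document; each statement's English description precedes it below -/
import Mathlib

section
/- Let A ∈ ℂ^{m×m} satisfy A D = G⊕ and Eᴴ A = (F⊕)ᴴ. Then A = C0 + E⊥ ((E⊥)ᴴ A D⊥) (D⊥)ᴴ. (Forward inclusion of the parametrization of the IC-DMD feasible set, Lemma A.1.) -/
open Matrix

/-- Moore–Penrose pseudo-inverse of a full-column-rank matrix: `D† = (DᴴD)⁻¹Dᴴ`. -/
noncomputable def pinv {m g : ℕ} (D : Matrix (Fin m) (Fin g) ℂ) : Matrix (Fin g) (Fin m) ℂ :=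
  (Dᴴ * D)⁻¹ * Dᴴ

/-- Forward inclusion of the parametrization of the IC-DMD feasible set (Lemma A.1):
any feasible `A` equals `C0 + E⊥ ((E⊥)ᴴ A D⊥) (D⊥)ᴴ`. -/
theorem stmt0 {m g f : ℕ} (hg : g ≤ m) (hf : f ≤ m)
    (D G : Matrix (Fin m) (Fin g) ℂ) (E F : Matrix (Fin m) (Fin f) ℂ)
    (hD : LinearIndependent ℂ Dᵀ) (hE : LinearIndependent ℂ Eᵀ)
    (hcompat : Eᴴ * G = Fᴴ * D)
    (Dp : Matrix (Fin m) (Fin (m - g)) ℂ) (Ep : Matrix (Fin m) (Fin (m - f)) ℂ)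
    (hDp : Dpᴴ * Dp = 1) (hEp : Epᴴ * Ep = 1)
    (hDsplit : (1 : Matrix (Fin m) (Fin m) ℂ) = D * pinv D + Dp * Dpᴴ)
    (hEsplit : (1 : Matrix (Fin m) (Fin m) ℂ) = E * pinv E + Ep * Epᴴ)
    (C0 : Matrix (Fin m) (Fin m) ℂ)
    (hC0 : C0 = G * pinv D + (pinv E)ᴴ * Fᴴ * Dp * Dpᴴ)
    (A : Matrix (Fin m) (Fin m) ℂ)
    (hAD : A * D = G) (hEA : Eᴴ * A = Fᴴ) :
    A = C0 + Ep * (Epᴴ * A * Dp) * Dpᴴ := by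
  have hE' : (1 : Matrix (Fin m) (Fin m) ℂ) = (pinv E)ᴴ * Eᴴ + Ep * Epᴴ := by
    simpa only [conjTranspose_one, conjTranspose_add, conjTranspose_mul,
      conjTranspose_conjTranspose] using congrArg conjTranspose hEsplit
  calc A = A * (D * pinv D + Dp * Dpᴴ) := by rw [← hDsplit, Matrix.mul_one]
    _ = A * D * pinv D + 1 * (A * Dp * Dpᴴ) := by
      simp only [Matrix.mul_add, Matrix.mul_assoc, Matrix.one_mul]
    _ = A * D * pinv D + (pinv E)ᴴ * (Eᴴ * A) * Dp * Dpᴴ + Ep * (Epᴴ * A * Dp) * Dpᴴ := by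
      rw [hE']
      simp only [Matrix.add_mul, Matrix.mul_assoc, add_assoc]
    _ = C0 + Ep * (Epᴴ * A * Dp) * Dpᴴ := by rw [hAD, hEA, hC0]
end

section
/- For every matrix Ã ∈ ℂ^{(m−f)×(m−g)}, the matrix C0 + E⊥ Ã (D⊥)ᴴ satisfies (C0 + E⊥ Ã (D⊥)ᴴ) D = G⊕ and Eᴴ (C0 + E⊥ Ã (D⊥)ᴴ) = (F⊕)ᴴ, i.e., it belongs to the feasible set 𝒜. (Reverse inclusion of the parametrization of the IC-DMD feasible set, Lemma A.1.) -/
open Matrix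

open scoped ComplexOrder in
theorem pinv_mul_self {m g : ℕ} {D : Matrix (Fin m) (Fin g) ℂ}
    (hD : LinearIndependent ℂ Dᵀ) : pinv D * D = 1 := by
  have hpos : (Dᴴ * D).PosDef :=
    Matrix.PosDef.conjTranspose_mul_self D (Matrix.mulVec_injective_iff.mpr hD)
  rw [pinv, Matrix.mul_assoc,
    Matrix.nonsing_inv_mul _ ((Matrix.isUnit_iff_isUnit_det _).mp hpos.isUnit)]

/-- An isometry completing the range projection of `D` has range orthogonal to that of `D`. -/
theorem conjTranspose_mul_eq_zero_of_one_eq_add {m g k : ℕ} {D : Matrix (Fin m) (Fin g) ℂ}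
    {P : Matrix (Fin m) (Fin k) ℂ} (hD : LinearIndependent ℂ Dᵀ) (hP : Pᴴ * P = 1)
    (hsplit : 1 = D * pinv D + P * Pᴴ) : Pᴴ * D = 0 := by
  have h : P * (Pᴴ * D) = 0 := by
    have := congrArg (· * D) hsplit
    simpa [Matrix.add_mul, Matrix.mul_assoc, pinv_mul_self hD] using this
  rw [← Matrix.one_mul (Pᴴ * D), ← hP, Matrix.mul_assoc, h, Matrix.mul_zero]

/-- Reverse inclusion of the parametrization of the IC-DMD feasible set (Lemma A.1):
for every `Ã`, the matrix `C0 + E⊥ Ã (D⊥)ᴴ` is feasible. -/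
theorem stmt1 {m g f : ℕ} (hg : g ≤ m) (hf : f ≤ m)
    (D G : Matrix (Fin m) (Fin g) ℂ) (E F : Matrix (Fin m) (Fin f) ℂ)
    (hD : LinearIndependent ℂ Dᵀ) (hE : LinearIndependent ℂ Eᵀ)
    (hcompat : Eᴴ * G = Fᴴ * D)
    (Dp : Matrix (Fin m) (Fin (m - g)) ℂ) (Ep : Matrix (Fin m) (Fin (m - f)) ℂ)
    (hDp : Dpᴴ * Dp = 1) (hEp : Epᴴ * Ep = 1)
    (hDsplit : (1 : Matrix (Fin m) (Fin m) ℂ) = D * pinv D + Dp * Dpᴴ)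
    (hEsplit : (1 : Matrix (Fin m) (Fin m) ℂ) = E * pinv E + Ep * Epᴴ)
    (C0 : Matrix (Fin m) (Fin m) ℂ)
    (hC0 : C0 = G * pinv D + (pinv E)ᴴ * Fᴴ * Dp * Dpᴴ) :
    ∀ At : Matrix (Fin (m - f)) (Fin (m - g)) ℂ,
      (C0 + Ep * At * Dpᴴ) * D = G ∧ Eᴴ * (C0 + Ep * At * Dpᴴ) = Fᴴ := by
  intro At
  have hDpD := conjTranspose_mul_eq_zero_of_one_eq_add hD hDp hDsplit
  have hEEp : Eᴴ * Ep = 0 := by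
    simpa using congrArg conjTranspose
      (conjTranspose_mul_eq_zero_of_one_eq_add hE hEp hEsplit)
  have hEE : Eᴴ * (pinv E)ᴴ = 1 := by
    rw [← conjTranspose_mul, pinv_mul_self hE, conjTranspose_one]
  subst hC0
  constructor
  · simp only [Matrix.add_mul, Matrix.mul_assoc, pinv_mul_self hD, hDpD, Matrix.mul_zero,
      Matrix.mul_one, add_zero]
  · calc Eᴴ * (G * pinv D + (pinv E)ᴴ * Fᴴ * Dp * Dpᴴ + Ep * At * Dpᴴ)
        = Eᴴ * G * pinv D + Eᴴ * (pinv E)ᴴ * (Fᴴ * (Dp * Dpᴴ)) + Eᴴ * Ep * (At * Dpᴴ) := by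
          simp only [Matrix.mul_add, Matrix.mul_assoc]
      _ = Fᴴ * (D * pinv D + Dp * Dpᴴ) := by
          rw [hcompat, hEE, hEEp, Matrix.one_mul, Matrix.zero_mul, add_zero, Matrix.mul_add,
            Matrix.mul_assoc]
      _ = Fᴴ := by rw [← hDsplit, Matrix.mul_one]
end

section
/- The matrix C0 := G⊕ D† + (E†)ᴴ (F⊕)ᴴ D⊥ (D⊥)ᴴ is feasible for the IC-DMD constraints: C0 D = G⊕ and Eᴴ C0 = (F⊕)ᴴ. -/
open Matrix

/-- The matrix `C0 := G⊕ D† + (E†)ᴴ (F⊕)ᴴ D⊥ (D⊥)ᴴ` is feasible for the IC-DMD constraints: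
`C0 D = G⊕` and `Eᴴ C0 = (F⊕)ᴴ`. -/
theorem stmt2 {m g f : ℕ} (hg : g ≤ m) (hf : f ≤ m)
    (D G : Matrix (Fin m) (Fin g) ℂ) (E F : Matrix (Fin m) (Fin f) ℂ)
    (hD : LinearIndependent ℂ Dᵀ) (hE : LinearIndependent ℂ Eᵀ)
    (hcompat : Eᴴ * G = Fᴴ * D)
    (Dp : Matrix (Fin m) (Fin (m - g)) ℂ) (Ep : Matrix (Fin m) (Fin (m - f)) ℂ)
    (hDp : Dpᴴ * Dp = 1) (hEp : Epᴴ * Ep = 1)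
    (hDsplit : (1 : Matrix (Fin m) (Fin m) ℂ) = D * pinv D + Dp * Dpᴴ)
    (hEsplit : (1 : Matrix (Fin m) (Fin m) ℂ) = E * pinv E + Ep * Epᴴ)
    (C0 : Matrix (Fin m) (Fin m) ℂ)
    (hC0 : C0 = G * pinv D + (pinv E)ᴴ * Fᴴ * Dp * Dpᴴ) :
    C0 * D = G ∧ Eᴴ * C0 = Fᴴ := by
  have hDl := pinv_mul_self hD
  have hEl : Eᴴ * (pinv E)ᴴ = 1 := by
    rw [← Matrix.conjTranspose_mul, pinv_mul_self hE, Matrix.conjTranspose_one]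
  have hproj : Dp * Dpᴴ * D = 0 := by
    rw [← sub_eq_iff_eq_add'.2 hDsplit, Matrix.sub_mul, Matrix.mul_assoc, hDl,
      Matrix.one_mul, Matrix.mul_one, sub_self]
  subst hC0
  constructor
  · rw [Matrix.add_mul, Matrix.mul_assoc G, hDl, Matrix.mul_one,
      Matrix.mul_assoc _ Dp, Matrix.mul_assoc _ (Dp * Dpᴴ), hproj, Matrix.mul_zero, add_zero]
  · calc Eᴴ * (G * pinv D + (pinv E)ᴴ * Fᴴ * Dp * Dpᴴ)
        = Eᴴ * G * pinv D + Eᴴ * (pinv E)ᴴ * (Fᴴ * (Dp * Dpᴴ)) := by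
          simp only [Matrix.mul_add, Matrix.mul_assoc]
      _ = Fᴴ * (D * pinv D + Dp * Dpᴴ) := by
          rw [hEl, hcompat, Matrix.one_mul, Matrix.mul_add, Matrix.mul_assoc]
      _ = Fᴴ := by rw [← hDsplit, Matrix.mul_one]
end

section
/- Let X, Y ∈ ℂ^{m×n} be data matrices. Suppose Ã* ∈ ℂ^{(m−f)×(m−g)} minimizes the map Ã ↦ ‖Ã ((D⊥)ᴴ X) − (E⊥)ᴴ (Y − C0 X)‖_F² over all Ã ∈ ℂ^{(m−f)×(m−g)}. Then the matrix A* := C0 + E⊥ Ã* (D⊥)ᴴ belongs to 𝒜 and minimizes ‖A X − Y‖_F over all A ∈ 𝒜, i.e., ‖A* X − Y‖_F ≤ ‖A X − Y‖_F for every A ∈ 𝒜. (Theorem: construction of an IC-DMD minimizer.) -/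
open Matrix

/-- Squared Frobenius norm of a complex matrix. -/
noncomputable def frobSq {m n : ℕ} (A : Matrix (Fin m) (Fin n) ℂ) : ℝ :=
  ∑ i, ∑ j, ‖A i j‖ ^ 2

/-- Frobenius norm of a complex matrix. -/
noncomputable def frob {m n : ℕ} (A : Matrix (Fin m) (Fin n) ℂ) : ℝ :=
  Real.sqrt (frobSq A)

theorem conjTranspose_mul_eq_zero_of_split {m g k : ℕ} {D : Matrix (Fin m) (Fin g) ℂ}
    {Dp : Matrix (Fin m) (Fin k) ℂ} (hD : LinearIndependent ℂ Dᵀ) (hDp : Dpᴴ * Dp = 1)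
    (hsplit : (1 : Matrix (Fin m) (Fin m) ℂ) = D * pinv D + Dp * Dpᴴ) : Dpᴴ * D = 0 := by
  have h := congrArg (· * D) hsplit
  simp only [Matrix.one_mul, Matrix.add_mul, Matrix.mul_assoc, pinv_mul_self hD,
    Matrix.mul_one, left_eq_add] at h
  simpa [← Matrix.mul_assoc, hDp] using congrArg (Dpᴴ * ·) h

theorem frobSq_eq_re_trace {m n : ℕ} (A : Matrix (Fin m) (Fin n) ℂ) :
    frobSq A = (Aᴴ * A).trace.re := by
  rw [frobSq, Finset.sum_comm]
  simp [Matrix.trace, Matrix.mul_apply, ← Complex.normSq_eq_norm_sq, Complex.normSq_apply]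

/-- Pythagorean splitting of the residual of a least-squares problem along the range of an
isometry. -/
theorem frobSq_isometry_mul_sub {m k n : ℕ} {Q : Matrix (Fin m) (Fin k) ℂ} (hQ : Qᴴ * Q = 1)
    (S : Matrix (Fin k) (Fin n) ℂ) (Z : Matrix (Fin m) (Fin n) ℂ) :
    frobSq (Q * S - Z) = frobSq (S - Qᴴ * Z) + (frobSq Z - frobSq (Qᴴ * Z)) := by
  have hQS : Qᴴ * (Q * S) = S := by rw [← Matrix.mul_assoc, hQ, Matrix.one_mul]
  simp only [frobSq_eq_re_trace, ← Complex.add_re, ← Complex.sub_re, ← Matrix.trace_add,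
    ← Matrix.trace_sub]
  congr 2
  simp only [Matrix.conjTranspose_sub, Matrix.conjTranspose_mul, Matrix.conjTranspose_conjTranspose,
    Matrix.sub_mul, Matrix.mul_sub, Matrix.mul_assoc, hQS]
  abel

/-- Construction of an IC-DMD minimizer: if `Ã*` minimizes the reduced least-squares
objective, then `A* := C0 + E⊥ Ã* (D⊥)ᴴ` is feasible and minimizes `‖A X − Y‖_F`
over the feasible set `𝒜`. -/
theorem stmt3 {m g f n : ℕ} (hg : g ≤ m) (hf : f ≤ m)
    (D G : Matrix (Fin m) (Fin g) ℂ) (E F : Matrix (Fin m) (Fin f) ℂ)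
    (hD : LinearIndependent ℂ Dᵀ) (hE : LinearIndependent ℂ Eᵀ)
    (hcompat : Eᴴ * G = Fᴴ * D)
    (Dp : Matrix (Fin m) (Fin (m - g)) ℂ) (Ep : Matrix (Fin m) (Fin (m - f)) ℂ)
    (hDp : Dpᴴ * Dp = 1) (hEp : Epᴴ * Ep = 1)
    (hDsplit : (1 : Matrix (Fin m) (Fin m) ℂ) = D * pinv D + Dp * Dpᴴ)
    (hEsplit : (1 : Matrix (Fin m) (Fin m) ℂ) = E * pinv E + Ep * Epᴴ)
    (C0 : Matrix (Fin m) (Fin m) ℂ)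
    (hC0 : C0 = G * pinv D + (pinv E)ᴴ * Fᴴ * Dp * Dpᴴ)
    (X Y : Matrix (Fin m) (Fin n) ℂ)
    (At : Matrix (Fin (m - f)) (Fin (m - g)) ℂ)
    (hAt : ∀ B : Matrix (Fin (m - f)) (Fin (m - g)) ℂ,
      frobSq (At * (Dpᴴ * X) - Epᴴ * (Y - C0 * X)) ≤
        frobSq (B * (Dpᴴ * X) - Epᴴ * (Y - C0 * X)))
    (Astar : Matrix (Fin m) (Fin m) ℂ)
    (hAstar : Astar = C0 + Ep * At * Dpᴴ) :
    (Astar * D = G ∧ Eᴴ * Astar = Fᴴ) ∧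
      ∀ A : Matrix (Fin m) (Fin m) ℂ, A * D = G → Eᴴ * A = Fᴴ →
        frob (Astar * X - Y) ≤ frob (A * X - Y) := by
  have hDD := pinv_mul_self hD
  have hEE : Eᴴ * (pinv E)ᴴ = 1 := by
    rw [← Matrix.conjTranspose_mul, pinv_mul_self hE, Matrix.conjTranspose_one]
  have hDpD := conjTranspose_mul_eq_zero_of_split hD hDp hDsplit
  have hEEp : Eᴴ * Ep = 0 := by
    simpa using congrArg Matrix.conjTranspose
      (conjTranspose_mul_eq_zero_of_split hE hEp hEsplit)
  have hC0D : C0 * D = G := by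
    simp [hC0, Matrix.add_mul, Matrix.mul_assoc, hDD, hDpD]
  have hEC0 : Eᴴ * C0 = Fᴴ := by
    calc Eᴴ * C0 = (Eᴴ * G) * pinv D + (Eᴴ * (pinv E)ᴴ) * Fᴴ * Dp * Dpᴴ := by
          simp only [hC0, Matrix.mul_add, Matrix.mul_assoc]
      _ = Fᴴ * (D * pinv D + Dp * Dpᴴ) := by
          rw [hcompat, hEE, Matrix.one_mul, Matrix.mul_add, Matrix.mul_assoc, Matrix.mul_assoc]
      _ = Fᴴ := by rw [← hDsplit, Matrix.mul_one]
  have hres (B : Matrix (Fin (m - f)) (Fin (m - g)) ℂ) :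
      (C0 + Ep * B * Dpᴴ) * X - Y = Ep * (B * (Dpᴴ * X)) - (Y - C0 * X) := by
    simp only [Matrix.add_mul, Matrix.mul_assoc]
    abel
  subst hAstar
  refine ⟨⟨?_, ?_⟩, fun A hAD hEA => ?_⟩
  · simp [Matrix.add_mul, Matrix.mul_assoc, hC0D, hDpD]
  · simp [Matrix.mul_add, ← Matrix.mul_assoc, hEC0, hEEp]
  have hMD : (A - C0) * D = 0 := by rw [Matrix.sub_mul, hAD, hC0D, sub_self]
  have hEM : Eᴴ * (A - C0) = 0 := by rw [Matrix.mul_sub, hEA, hEC0, sub_self]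
  have hright : (A - C0) * (Dp * Dpᴴ) = A - C0 := by
    conv_rhs => rw [← Matrix.mul_one (A - C0), hDsplit, Matrix.mul_add, ← Matrix.mul_assoc, hMD]
    simp
  have hEsplit' : (1 : Matrix (Fin m) (Fin m) ℂ) = (pinv E)ᴴ * Eᴴ + Ep * Epᴴ := by
    simpa using congrArg Matrix.conjTranspose hEsplit
  have hleft : (Ep * Epᴴ) * (A - C0) = A - C0 := by
    conv_rhs => rw [← Matrix.one_mul (A - C0), hEsplit', Matrix.add_mul, Matrix.mul_assoc, hEM]
    simp
  have hA : A = C0 + Ep * (Epᴴ * (A - C0) * Dp) * Dpᴴ := by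
    calc A = C0 + Ep * Epᴴ * (A - C0) * (Dp * Dpᴴ) := by rw [hleft, hright]; abel
      _ = _ := by simp only [Matrix.mul_assoc]
  rw [hA, hres, hres]
  refine Real.sqrt_le_sqrt ?_
  rw [frobSq_isometry_mul_sub hEp, frobSq_isometry_mul_sub hEp]
  gcongr
  exact hAt _
end

section
/- Let X, Y ∈ ℂ^{m×n} and let Q_E ∈ ℂ^{m×f} have orthonormal columns with Q_E Q_Eᴴ = E E† (i.e., the columns of Q_E form an orthonormal basis of the column space of E). Then for every Ã ∈ ℂ^{(m−f)×(m−g)}: ‖(C0 + E⊥ Ã (D⊥)ᴴ) X − Y‖_F² = ‖Ã ((D⊥)ᴴ X) − (E⊥)ᴴ (Y − C0 X)‖_F² + ‖Q_Eᴴ (Y − C0 X)‖_F². (Objective decomposition identity used to prove the IC-DMD minimizer theorem.) -/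
open Matrix

theorem ofReal_frobSq {m n : ℕ} (A : Matrix (Fin m) (Fin n) ℂ) :
    (frobSq A : ℂ) = (Aᴴ * A).trace := by
  simp only [frobSq, trace, diag, mul_apply, conjTranspose_apply, Complex.star_def,
    Complex.conj_mul']
  push_cast
  exact Finset.sum_comm

theorem frobSq_neg {m n : ℕ} (A : Matrix (Fin m) (Fin n) ℂ) : frobSq (-A) = frobSq A := by
  simp [frobSq]

/-- Pythagoras for a resolution of the identity `P Pᴴ + Q Qᴴ = 1`. -/
theorem frobSq_eq_add_of_mul_conjTranspose_add_eq_one {m k l n : ℕ}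
    {P : Matrix (Fin m) (Fin k) ℂ} {Q : Matrix (Fin m) (Fin l) ℂ} (h : P * Pᴴ + Q * Qᴴ = 1)
    (A : Matrix (Fin m) (Fin n) ℂ) : frobSq A = frobSq (Pᴴ * A) + frobSq (Qᴴ * A) := by
  apply Complex.ofReal_injective
  rw [Complex.ofReal_add, ofReal_frobSq, ofReal_frobSq, ofReal_frobSq, ← trace_add]
  congr 1
  calc Aᴴ * A = Aᴴ * ((P * Pᴴ + Q * Qᴴ) * A) := by rw [h, Matrix.one_mul]
    _ = _ := by
      simp only [conjTranspose_mul, conjTranspose_conjTranspose, Matrix.add_mul, Matrix.mul_add,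
        Matrix.mul_assoc]

/-- Objective decomposition identity used to prove the IC-DMD minimizer theorem:
`‖(C0 + E⊥ Ã (D⊥)ᴴ) X − Y‖_F² = ‖Ã ((D⊥)ᴴ X) − (E⊥)ᴴ(Y − C0 X)‖_F² + ‖Q_Eᴴ (Y − C0 X)‖_F²`. -/
theorem stmt4 {m g f n : ℕ} (hg : g ≤ m) (hf : f ≤ m)
    (D G : Matrix (Fin m) (Fin g) ℂ) (E F : Matrix (Fin m) (Fin f) ℂ)
    (hD : LinearIndependent ℂ Dᵀ) (hE : LinearIndependent ℂ Eᵀ)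
    (hcompat : Eᴴ * G = Fᴴ * D)
    (Dp : Matrix (Fin m) (Fin (m - g)) ℂ) (Ep : Matrix (Fin m) (Fin (m - f)) ℂ)
    (hDp : Dpᴴ * Dp = 1) (hEp : Epᴴ * Ep = 1)
    (hDsplit : (1 : Matrix (Fin m) (Fin m) ℂ) = D * pinv D + Dp * Dpᴴ)
    (hEsplit : (1 : Matrix (Fin m) (Fin m) ℂ) = E * pinv E + Ep * Epᴴ)
    (C0 : Matrix (Fin m) (Fin m) ℂ)
    (hC0 : C0 = G * pinv D + (pinv E)ᴴ * Fᴴ * Dp * Dpᴴ)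
    (X Y : Matrix (Fin m) (Fin n) ℂ)
    (QE : Matrix (Fin m) (Fin f) ℂ)
    (hQE1 : QEᴴ * QE = 1) (hQE2 : QE * QEᴴ = E * pinv E) :
    ∀ At : Matrix (Fin (m - f)) (Fin (m - g)) ℂ,
      frobSq ((C0 + Ep * At * Dpᴴ) * X - Y) =
        frobSq (At * (Dpᴴ * X) - Epᴴ * (Y - C0 * X)) + frobSq (QEᴴ * (Y - C0 * X)) := by
  intro At
  have hsum : Ep * Epᴴ + QE * QEᴴ = 1 := by rw [hQE2, hEsplit, add_comm]
  have horth : QEᴴ * Ep = 0 := by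
    have h : QEᴴ * (Ep * Epᴴ + QE * QEᴴ) * Ep = QEᴴ * Ep := by rw [hsum, Matrix.mul_one]
    have h' : QEᴴ * (Ep * Epᴴ + QE * QEᴴ) * Ep = QEᴴ * Ep * (Epᴴ * Ep) + QEᴴ * QE * (QEᴴ * Ep) := by
      simp only [Matrix.add_mul, Matrix.mul_add, Matrix.mul_assoc]
    rw [h', hEp, hQE1, Matrix.mul_one, Matrix.one_mul] at h
    exact left_eq_add.mp h.symm
  have hres : (C0 + Ep * At * Dpᴴ) * X - Y = Ep * (At * (Dpᴴ * X)) - (Y - C0 * X) := by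
    simp only [Matrix.add_mul, Matrix.mul_assoc]
    abel
  rw [frobSq_eq_add_of_mul_conjTranspose_add_eq_one hsum, hres, Matrix.mul_sub, Matrix.mul_sub QEᴴ,
    ← Matrix.mul_assoc Epᴴ, hEp, Matrix.one_mul, ← Matrix.mul_assoc QEᴴ, horth, Matrix.zero_mul,
    zero_sub, frobSq_neg]
end

section
/- Let X, Y ∈ ℂ^{m×n}. Under the stated assumptions on D, G⊕, E, F⊕, the feasible set 𝒜 is nonempty and the constrained least-squares problem min_{A ∈ 𝒜} ‖A X − Y‖_F attains its minimum: there exists A* ∈ 𝒜 with ‖A* X − Y‖_F ≤ ‖A X − Y‖_F for all A ∈ 𝒜. -/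
open Matrix

/-- A matrix over a field with linearly independent columns has a left inverse. -/
theorem Matrix.exists_mul_eq_one_of_linearIndependent_transpose {K ι κ : Type*} [Field K]
    [Fintype ι] [DecidableEq ι] [Fintype κ] [DecidableEq κ] {M : Matrix ι κ K}
    (hM : LinearIndependent K Mᵀ) : ∃ L : Matrix κ ι K, L * M = 1 := by
  obtain ⟨l, hl⟩ := M.mulVecLin.exists_leftInverse_of_injective
    (LinearMap.ker_eq_bot.mpr (mulVec_injective_iff.mpr hM))
  refine ⟨LinearMap.toMatrix' l, (Matrix.toLin' (R := K)).injective ?_⟩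
  rw [toLin'_mul, toLin'_toMatrix', toLin'_one]
  exact hl

/-- The equations `A * D = G` and `C * A = H` have a common solution if they are compatible,
`D` has a left inverse and `C` has a right inverse. -/
theorem Matrix.exists_mul_eq_and_mul_eq {R ι κ γ φ : Type*} [Ring R] [Fintype ι] [Fintype κ]
    [Fintype γ] [DecidableEq γ] [Fintype φ] [DecidableEq φ]
    {D : Matrix κ γ R} {G : Matrix ι γ R} {C : Matrix φ ι R} {H : Matrix φ κ R}
    {L : Matrix γ κ R} {S : Matrix ι φ R} (hL : L * D = 1) (hS : C * S = 1)
    (hcompat : C * G = H * D) : ∃ A : Matrix ι κ R, A * D = G ∧ C * A = H := by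
  refine ⟨G * L + S * H - S * (C * G) * L, ?_, ?_⟩
  · rw [Matrix.sub_mul, Matrix.add_mul, Matrix.mul_assoc G, Matrix.mul_assoc _ L, hL,
      Matrix.mul_assoc S H, ← hcompat]
    simp
  · rw [Matrix.mul_sub, Matrix.mul_add, ← Matrix.mul_assoc C S, Matrix.mul_assoc S,
      ← Matrix.mul_assoc C S, hS, ← Matrix.mul_assoc C G]
    simp

section Frobenius

attribute [local instance] Matrix.frobeniusNormedAddCommGroup Matrix.frobeniusNormedSpace

theorem frob_eq_norm {m n : ℕ} (A : Matrix (Fin m) (Fin n) ℂ) : frob A = ‖A‖ := by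
  simp [frob, frobSq, frobenius_norm_def, Real.sqrt_eq_rpow]

/-- The image of a linear subspace of matrices under right multiplication by `X` contains a point
closest to any given matrix. -/
theorem exists_forall_frob_mul_sub_le {m n : ℕ} (V : Submodule ℂ (Matrix (Fin m) (Fin m) ℂ))
    (X Z : Matrix (Fin m) (Fin n) ℂ) : ∃ B ∈ V, ∀ B' ∈ V, frob (B * X - Z) ≤ frob (B' * X - Z) := by
  have : ProperSpace (Matrix (Fin m) (Fin n) ℂ) := FiniteDimensional.proper ℂ _
  let W := V.map (mulRightLinearMap (Fin m) ℂ X)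
  obtain ⟨_, ⟨B, hB, rfl⟩, hd⟩ :=
    W.closed_of_finiteDimensional.exists_infDist_eq_dist W.nonempty Z
  refine ⟨B, hB, fun B' hB' ↦ ?_⟩
  have h := Metric.infDist_le_dist_of_mem (x := Z) (Submodule.mem_map_of_mem hB' :
    mulRightLinearMap (Fin m) ℂ X B' ∈ W)
  rw [hd, dist_comm, dist_comm Z, dist_eq_norm, dist_eq_norm] at h
  simpa only [frob_eq_norm, mulRightLinearMap_apply] using h

end Frobenius

/-- The IC-DMD feasible set `𝒜 = {A | A D = G⊕, Eᴴ A = (F⊕)ᴴ}` is nonempty and the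
constrained least-squares problem `min_{A ∈ 𝒜} ‖A X − Y‖_F` attains its minimum. -/
theorem stmt5 {m g f n : ℕ} (hg : g ≤ m) (hf : f ≤ m)
    (D G : Matrix (Fin m) (Fin g) ℂ) (E F : Matrix (Fin m) (Fin f) ℂ)
    (hD : LinearIndependent ℂ Dᵀ) (hE : LinearIndependent ℂ Eᵀ)
    (hcompat : Eᴴ * G = Fᴴ * D)
    (X Y : Matrix (Fin m) (Fin n) ℂ) :
    ∃ Astar : Matrix (Fin m) (Fin m) ℂ,
      (Astar * D = G ∧ Eᴴ * Astar = Fᴴ) ∧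
        ∀ A : Matrix (Fin m) (Fin m) ℂ, A * D = G → Eᴴ * A = Fᴴ →
          frob (Astar * X - Y) ≤ frob (A * X - Y) := by
  obtain ⟨L, hL⟩ := exists_mul_eq_one_of_linearIndependent_transpose hD
  obtain ⟨S, hS⟩ := exists_mul_eq_one_of_linearIndependent_transpose hE
  have hS' : Eᴴ * Sᴴ = 1 := by rw [← conjTranspose_mul, hS, conjTranspose_one]
  obtain ⟨A₀, hA₀D, hA₀E⟩ := exists_mul_eq_and_mul_eq hL hS' hcompat
  let V := (mulRightLinearMap (Fin m) ℂ D).ker ⊓ (mulLeftLinearMap (Fin m) ℂ Eᴴ).ker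
  have hV (B : Matrix (Fin m) (Fin m) ℂ) : B ∈ V ↔ B * D = 0 ∧ Eᴴ * B = 0 := by simp [V]
  obtain ⟨B, hB, hmin⟩ := exists_forall_frob_mul_sub_le V X (Y - A₀ * X)
  obtain ⟨hBD, hBE⟩ := (hV B).mp hB
  refine ⟨A₀ + B, ⟨by simp [Matrix.add_mul, hA₀D, hBD], by simp [Matrix.mul_add, hA₀E, hBE]⟩,
    fun A hAD hAE ↦ ?_⟩
  have h := hmin (A - A₀) ((hV _).mpr
    ⟨by simp [Matrix.sub_mul, hA₀D, hAD], by simp [Matrix.mul_sub, hA₀E, hAE]⟩)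
  convert h using 2
  · rw [Matrix.add_mul]; abel
  · rw [Matrix.sub_mul]; abel
end

section
/- Suppose the pair (Â, b̂) ∈ ℂ^{(m−1)×(m−1)} × ℂ^{m−1} minimizes the map (A₂₂, A₂₁) ↦ ‖A₂₂ X₂ + A₂₁ 1ₙᴴ − Y₂‖_F² over all such pairs. Then the block matrix A_Affine := [[1, 0ᴴ],[b̂, Â]] (first row equal to e₁ᴴ, lower-left block b̂, lower-right block Â) minimizes A ↦ ‖A X − Y‖_F over the constraint set 𝒜₁ := {A ∈ ℂ^{m×m} : the first row of A equals e₁ᴴ}. (Recovery of Affine DMD by IC-DMD, Proposition on Affine DMD, part 2.) -/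
open Matrix

/-- For `A` with first row `e₁ᴴ` and data whose first rows are all ones, the residual `A X - Y`
has zero first row, so its squared Frobenius norm is that of the affine residual. -/
theorem frobSq_mul_sub_eq_affine {m n : ℕ}
    {X Y : Matrix (Fin (m + 1)) (Fin n) ℂ}
    (hX : ∀ j, X 0 j = 1) (hY : ∀ j, Y 0 j = 1)
    {A : Matrix (Fin (m + 1)) (Fin (m + 1)) ℂ} (hA : ∀ j, A 0 j = if j = 0 then 1 else 0) :
    frobSq (A * X - Y) =
      frobSq (A.submatrix Fin.succ Fin.succ * X.submatrix Fin.succ id +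
        Matrix.of (fun i (_ : Fin n) => A (Fin.succ i) 0) -
          Y.submatrix Fin.succ id) := by
  unfold frobSq
  rw [Fin.sum_univ_succ]
  simp [Matrix.mul_apply, Fin.sum_univ_succ, hA, hX, hY, add_comm]

/-- Recovery of Affine DMD by IC-DMD (Proposition, part 2).  The total dimension is
`m + 1` (so blocks have size `m`, with `m ≥ 1`).  If `(Â, b̂)` minimizes
`(A₂₂, A₂₁) ↦ ‖A₂₂ X₂ + A₂₁ 1ₙᴴ − Y₂‖_F²`, then the block matrix
`[[1, 0ᴴ],[b̂, Â]]` minimizes `‖A X − Y‖_F` over matrices whose first row is `e₁ᴴ`. -/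
theorem stmt6 {m n : ℕ} (hm : 1 ≤ m)
    (X Y : Matrix (Fin (m + 1)) (Fin n) ℂ)
    (hX : ∀ j, X 0 j = 1) (hY : ∀ j, Y 0 j = 1)
    (X2 Y2 : Matrix (Fin m) (Fin n) ℂ)
    (hX2 : ∀ i j, X2 i j = X i.succ j) (hY2 : ∀ i j, Y2 i j = Y i.succ j)
    (Ahat : Matrix (Fin m) (Fin m) ℂ) (bhat : Fin m → ℂ)
    (hmin : ∀ (A22 : Matrix (Fin m) (Fin m) ℂ) (A21 : Fin m → ℂ),
      frobSq (Ahat * X2 + Matrix.of (fun i (_ : Fin n) => bhat i) - Y2) ≤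
        frobSq (A22 * X2 + Matrix.of (fun i (_ : Fin n) => A21 i) - Y2))
    (AAff : Matrix (Fin (m + 1)) (Fin (m + 1)) ℂ)
    (hAAff : AAff = Matrix.of (fun i j =>
      Fin.cases (Fin.cases (1 : ℂ) (fun _ => 0) j)
        (fun i' => Fin.cases (bhat i') (fun j' => Ahat i' j') j) i)) :
    (∀ j, AAff 0 j = if j = 0 then 1 else 0) ∧
      ∀ A : Matrix (Fin (m + 1)) (Fin (m + 1)) ℂ,
        (∀ j, A 0 j = if j = 0 then 1 else 0) →
        frob (AAff * X - Y) ≤ frob (A * X - Y) := by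
  obtain rfl : X2 = X.submatrix Fin.succ id := Matrix.ext hX2
  obtain rfl : Y2 = Y.submatrix Fin.succ id := Matrix.ext hY2
  have hrow : ∀ j, AAff 0 j = if j = 0 then 1 else 0 := by
    intro j
    subst hAAff
    cases j using Fin.cases <;> simp
  refine ⟨hrow, fun A hA => Real.sqrt_le_sqrt ?_⟩
  rw [frobSq_mul_sub_eq_affine hX hY hrow, frobSq_mul_sub_eq_affine hX hY hA]
  subst hAAff
  exact hmin _ _
end

section
/- Every minimizer A* of A ↦ ‖A X − Y‖_F over the constraint set 𝒜₁ := {A ∈ ℂ^{m×m} : the first row of A equals e₁ᴴ} satisfies, in its block decomposition A* = [[1, 0ᴴ],[A*₂₁, A*₂₂]], the mean relation A*₂₁ = μ_Y − A*₂₂ μ_X. (Proposition on Affine DMD, part 3; the analogue of the Affine DMD offset relation.) -/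
open Matrix

/-- Subtracting the mean `c` of `n` complex numbers lowers their sum of squares by `n ‖c‖²`. -/
theorem sum_norm_sub_mean_sq {n : ℕ} (r : Fin n → ℂ) (c : ℂ) (hc : ∑ j, r j = n * c) :
    ∑ j, ‖r j - c‖ ^ 2 = ∑ j, ‖r j‖ ^ 2 - n * ‖c‖ ^ 2 := by
  have hre : ∑ j, (r j).re = n * c.re := by simpa using congrArg Complex.re hc
  have him : ∑ j, (r j).im = n * c.im := by simpa using congrArg Complex.im hc
  have hj : ∀ j, ‖r j - c‖ ^ 2 =
      ‖r j‖ ^ 2 - 2 * c.re * (r j).re - 2 * c.im * (r j).im + ‖c‖ ^ 2 := by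
    intro j
    simp only [Complex.sq_norm, Complex.normSq_apply, Complex.sub_re, Complex.sub_im]
    ring
  simp only [hj, Finset.sum_add_distrib, Finset.sum_sub_distrib, ← Finset.mul_sum, hre, him]
  simp only [Finset.sum_const, Finset.card_univ, Fintype.card_fin, nsmul_eq_mul,
    Complex.sq_norm, Complex.normSq_apply]
  ring

theorem frobSq_nonneg {m n : ℕ} (A : Matrix (Fin m) (Fin n) ℂ) : 0 ≤ frobSq A :=
  Finset.sum_nonneg fun _ _ => Finset.sum_nonneg fun _ _ => sq_nonneg _

/-- Centering a single row of a matrix lowers its squared Frobenius norm accordingly. -/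
theorem frobSq_sub_row_mean {m n : ℕ} (R S : Matrix (Fin m) (Fin n) ℂ) (i : Fin m) (c : ℂ)
    (hc : ∑ j, R i j = n * c) (hS : ∀ k j, S k j = R k j - if k = i then c else 0) :
    frobSq S = frobSq R - n * ‖c‖ ^ 2 := by
  have hk : ∀ k, ∑ j, ‖S k j‖ ^ 2 =
      ∑ j, ‖R k j‖ ^ 2 - if k = i then n * ‖c‖ ^ 2 else 0 := by
    intro k
    by_cases h : k = i
    · subst h
      simpa [hS] using sum_norm_sub_mean_sq (R k) c hc
    · simp [hS, h]
  simp [frobSq, hk, Finset.sum_sub_distrib]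

/-- Proposition on Affine DMD, part 3 (the Affine-DMD offset relation).  The total
dimension is `m + 1` (blocks of size `m`, with `m ≥ 1`).  Every minimizer `A*` of
`A ↦ ‖A X − Y‖_F` over matrices with first row `e₁ᴴ` satisfies, in its block
decomposition `A* = [[1, 0ᴴ],[A*₂₁, A*₂₂]]`, the mean relation
`A*₂₁ = μ_Y − A*₂₂ μ_X`. -/
theorem stmt7 {m n : ℕ} (hm : 1 ≤ m) (hn : 0 < n)
    (X Y : Matrix (Fin (m + 1)) (Fin n) ℂ)
    (hX : ∀ j, X 0 j = 1) (hY : ∀ j, Y 0 j = 1)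
    (X2 Y2 : Matrix (Fin m) (Fin n) ℂ)
    (hX2 : ∀ i j, X2 i j = X i.succ j) (hY2 : ∀ i j, Y2 i j = Y i.succ j)
    (μX μY : Fin m → ℂ)
    (hμX : ∀ i, μX i = (∑ j, X2 i j) / (n : ℂ))
    (hμY : ∀ i, μY i = (∑ j, Y2 i j) / (n : ℂ))
    (Astar : Matrix (Fin (m + 1)) (Fin (m + 1)) ℂ)
    (hmem : ∀ j, Astar 0 j = if j = 0 then 1 else 0)
    (hmin : ∀ A : Matrix (Fin (m + 1)) (Fin (m + 1)) ℂ,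
      (∀ j, A 0 j = if j = 0 then 1 else 0) →
      frob (Astar * X - Y) ≤ frob (A * X - Y)) :
    ∀ i : Fin m, Astar i.succ 0 = μY i - ∑ j, Astar i.succ j.succ * μX j := by
  intro i
  have hn0 : (n : ℂ) ≠ 0 := by exact_mod_cast hn.ne'
  set R := Astar * X - Y with hR
  set c : ℂ := (∑ j, R i.succ j) / n with hcdef
  have hc : ∑ j, R i.succ j = n * c := by rw [hcdef]; field_simp
  let E : Matrix (Fin (m + 1)) (Fin (m + 1)) ℂ := Matrix.single i.succ 0 c
  have hle := hmin (Astar - E) (by simp [E, hmem])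
  have hS : ∀ k j, ((Astar - E) * X - Y) k j =
      R k j - if k = i.succ then c else 0 := by
    intro k j
    have h : (E * X) k j = if k = i.succ then c else 0 := by
      by_cases hk : k = i.succ
      · subst hk
        simp [E, hX]
      · simp [E, hk]
    rw [Matrix.sub_mul, Matrix.sub_apply, Matrix.sub_apply, h, hR, Matrix.sub_apply]
    ring
  have hsq := frobSq_sub_row_mean R _ i.succ c hc hS
  have hle' := (Real.sqrt_le_sqrt_iff (frobSq_nonneg _)).1 hle
  have hnpos : (0 : ℝ) < n := by exact_mod_cast hn
  have hc0 : c = 0 := by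
    by_contra hne
    have : 0 < (n : ℝ) * ‖c‖ ^ 2 := by positivity
    linarith
  have hrow : ∀ j, R i.succ j =
      Astar i.succ 0 + ∑ k : Fin m, Astar i.succ k.succ * X2 k j - Y2 i j := by
    intro j
    simp [hR, Matrix.mul_apply, Fin.sum_univ_succ, hX, hX2, hY2]
  have hsum : (n : ℂ) * Astar i.succ 0 + ∑ k : Fin m, Astar i.succ k.succ * ∑ j, X2 k j
      - ∑ j, Y2 i j = 0 := by
    rw [hc0, mul_zero] at hc
    rw [← hc]
    simp only [hrow, Finset.sum_add_distrib, Finset.sum_sub_distrib, Finset.mul_sum]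
    rw [Finset.sum_comm]
    simp
  simp only [hμX, hμY, ← mul_div_assoc, ← Finset.sum_div]
  field_simp
  linear_combination hsum
end

section
/- Let X, Y ∈ ℂ^{m×n} with X of full row rank (its rows are linearly independent), and let A_EDMD ∈ ℂ^{m×m} be any minimizer of A ↦ ‖A X − Y‖_F² over ℂ^{m×m}. If w ∈ ℂ^m and λ ∈ ℂ satisfy wᴴ Y = λ wᴴ X (the data reflects a Koopman eigen-function with eigenvalue λ in the span of the observables), then wᴴ A_EDMD = λ wᴴ. (EDMD preserves eigen-functions in the dictionary span when X has full row rank.) -/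
open Matrix

/-- Expansion of the squared Frobenius norm under a real multiple of a rank-one perturbation. -/
lemma frobSq_sub_smul_vecMulVec {m n : ℕ} (R : Matrix (Fin m) (Fin n) ℂ)
    (w : Fin m → ℂ) (u : Fin n → ℂ) (t : ℝ) :
    frobSq (R - (t : ℂ) • vecMulVec w u) =
      frobSq R - 2 * t * (∑ j, star (u j) * (star w ᵥ* R) j).re
        + t ^ 2 * ((∑ i, ‖w i‖ ^ 2) * ∑ j, ‖u j‖ ^ 2) := by
  have entry : ∀ i j, ‖(R - (t : ℂ) • vecMulVec w u) i j‖ ^ 2 =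
      ‖R i j‖ ^ 2 - 2 * t * (star (u j) * (star (w i) * R i j)).re
        + t ^ 2 * (‖w i‖ ^ 2 * ‖u j‖ ^ 2) := by
    intro i j
    simp only [← Complex.normSq_eq_norm_sq, Complex.normSq_apply, Matrix.sub_apply,
      Matrix.smul_apply, vecMulVec_apply, smul_eq_mul, Complex.sub_re, Complex.sub_im,
      Complex.mul_re, Complex.mul_im, Complex.ofReal_re, Complex.ofReal_im,
      Complex.star_def, Complex.conj_re, Complex.conj_im]
    ring
  have cross : (∑ j, star (u j) * (star w ᵥ* R) j).re =
      ∑ i, ∑ j, (star (u j) * (star (w i) * R i j)).re := by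
    rw [Finset.sum_comm, Complex.re_sum]
    refine Finset.sum_congr rfl fun j _ => ?_
    simp only [vecMul, dotProduct, Pi.star_apply]
    rw [Finset.mul_sum, Complex.re_sum]
  rw [cross, Finset.sum_mul_sum]
  simp only [frobSq, entry, Finset.sum_add_distrib, Finset.sum_sub_distrib, Finset.mul_sum]

/-- EDMD preserves eigen-functions in the dictionary span when `X` has full row rank:
if `A_EDMD` minimizes `‖A X − Y‖_F²` and `wᴴ Y = λ wᴴ X`, then `wᴴ A_EDMD = λ wᴴ`. -/
theorem stmt12 {m n : ℕ}
    (X Y : Matrix (Fin m) (Fin n) ℂ)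
    (hX : LinearIndependent ℂ (fun i => X i))
    (AE : Matrix (Fin m) (Fin m) ℂ)
    (hmin : ∀ B : Matrix (Fin m) (Fin m) ℂ, frobSq (AE * X - Y) ≤ frobSq (B * X - Y))
    (w : Fin m → ℂ) (lam : ℂ)
    (hw : star w ᵥ* Y = lam • (star w ᵥ* X)) :
    star w ᵥ* AE = lam • star w := by
  set v : Fin m → ℂ := star w ᵥ* AE - lam • star w with hv
  set u : Fin n → ℂ := v ᵥ* X with hu
  have hres : star w ᵥ* (AE * X - Y) = u := by
    rw [hu, hv, vecMul_sub, sub_vecMul, hw, smul_vecMul, vecMul_vecMul]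
  have hcross : (∑ j, star (u j) * (star w ᵥ* (AE * X - Y)) j).re = ∑ j, ‖u j‖ ^ 2 := by
    rw [hres, Complex.re_sum]
    refine Finset.sum_congr rfl fun j _ => ?_
    rw [← Complex.normSq_eq_norm_sq, Complex.normSq_apply]
    simp [Complex.mul_re]
  have hW : 0 ≤ ∑ i, ‖w i‖ ^ 2 := by positivity
  have hU : 0 ≤ ∑ j, ‖u j‖ ^ 2 := by positivity
  have hle (t : ℝ) :
      0 ≤ t ^ 2 * ((∑ i, ‖w i‖ ^ 2) * ∑ j, ‖u j‖ ^ 2) - 2 * t * ∑ j, ‖u j‖ ^ 2 := by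
    have h := hmin (AE - (t : ℂ) • vecMulVec w v)
    have hB : (AE - (t : ℂ) • vecMulVec w v) * X - Y =
        (AE * X - Y) - (t : ℂ) • vecMulVec w u := by
      rw [Matrix.sub_mul, Matrix.smul_mul, vecMulVec_mul, sub_right_comm]
    rw [hB, frobSq_sub_smul_vecMulVec, hcross] at h
    linarith
  have hU0 : ∑ j, ‖u j‖ ^ 2 = 0 := by
    generalize (∑ i, ‖w i‖ ^ 2) = W at hW hle
    generalize (∑ j, ‖u j‖ ^ 2) = U at hU hle
    have h := hle (1 / (W + 1))
    have hW1 : 0 < W + 1 := by linarith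
    have heq : (1 / (W + 1)) ^ 2 * (W * U) - 2 * (1 / (W + 1)) * U =
        -(U * (W + 2)) / (W + 1) ^ 2 := by
      field_simp
      ring
    rw [heq, le_div_iff₀ (by positivity)] at h
    nlinarith [mul_nonneg hU hW]
  have hu0 : v ᵥ* X = 0 := by
    rw [← hu]
    ext j
    have := (Finset.sum_eq_zero_iff_of_nonneg fun j _ => by positivity).1 hU0 j (Finset.mem_univ j)
    simpa using this
  have hv0 : v = 0 := vecMul_injective_iff.2 hX (hu0.trans (zero_vecMul X).symm)
  exact sub_eq_zero.1 hv0
end
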